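/- Fix an integer n ≥ 1 and σ ∈ {+1, -1}. Let u be the Duhamel solution of ∂_t u = ∂_x² u + ∂_x A with u(·,0) = 0, where A(y,s) = (4π)^{-1/2} (1+s)^{2^{-n} - 3/2} e^{-(y - 2σ s)²/(4(1+s))}; explicitly, u(x,t) = ∫_0^t ∫_ℝ ∂_x G_{t-s}(x-y) A(y,s) dy ds with G_τ(x) = (4πτ)^{-1/2} e^{-x²/(4τ)}. Let u_n(x,t) = σ (1+t)^{-1+2^{-(n+1)}} · 2^{-1-2^{-n}} (4π)^{-1/2} f_n(-σ x/√(1+t)). Then there exists C = C(n) > 0 such that for all t ≥ 0: ‖u(·,t) − u_n(·,t)‖_{L²(ℝ)} ≤ C (1+t)^{-3/4} and ‖∂_x u(·,t) − ∂_x u_n(·,t)‖_{L²(ℝ)} ≤ C (1+t)^{-5/4}. -/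

import Mathlib

open MeasureTheory Real Filter

/-- `f_n(z) = ∫_z^∞ ξ e^{-ξ²/4} (ξ - z)^{2^{-n} - 1} dξ`. -/
noncomputable def fn (n : ℕ) (z : ℝ) : ℝ :=
  ∫ ξ in Set.Ioi z, ξ * Real.exp (-ξ^2/4) * (ξ - z) ^ ((2:ℝ)^(-(n:ℝ)) - 1)

/-- The heat kernel `G_τ(x) = (4πτ)^{-1/2} e^{-x²/(4τ)}`. -/
noncomputable def heatKernel (τ x : ℝ) : ℝ := Real.exp (-x^2/(4*τ)) / Real.sqrt (4*π*τ)

/-- Duhamel solution of `∂_t u = ∂_x² u + ∂_x g`, `u(·,0)=0`: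
`u(x,t) = ∫_0^t ∫_ℝ ∂_x G_{t-s}(x-y) g(y,s) dy ds`. -/
noncomputable def duhamel (g : ℝ → ℝ → ℝ) (x t : ℝ) : ℝ :=
  ∫ s in (0:ℝ)..t, ∫ y : ℝ, deriv (fun x' => heatKernel (t - s) (x' - y)) x * g y s

/-- The Gaussian forcing `A(y,s) = (4π)^{-1/2} (1+s)^{2^{-n}-3/2} e^{-(y-2σs)²/(4(1+s))}`. -/
noncomputable def gaussForcing (n : ℕ) (σ : ℝ) (y s : ℝ) : ℝ :=
  (1 + s) ^ ((2:ℝ)^(-(n:ℝ)) - 3/2) * Real.exp (-(y - 2*σ*s)^2/(4*(1 + s)))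
    / Real.sqrt (4*π)

/-- `u_n(x,t) = σ (1+t)^{-1+2^{-(n+1)}} 2^{-1-2^{-n}} (4π)^{-1/2} f_n(-σx/√(1+t))`. -/
noncomputable def selfSimU (n : ℕ) (σ : ℝ) (x t : ℝ) : ℝ :=
  σ * (1 + t) ^ (-(1:ℝ) + (2:ℝ)^(-(n:ℝ) - 1)) *
    ((2:ℝ) ^ (-(1:ℝ) - (2:ℝ)^(-(n:ℝ))) / Real.sqrt (4*π)) *
    fn n (-σ * x / Real.sqrt (1 + t))


lemma aux_cs (μ : Measure ℝ) (a b : ℝ → ENNReal) (ha : AEMeasurable a μ) (hb : AEMeasurable b μ) :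
    (∫⁻ s, a s * b s ∂μ) ^ (2:ℝ) ≤ (∫⁻ s, a s ∂μ) * ∫⁻ s, a s * b s ^ (2:ℝ) ∂μ := by
  have h := ENNReal.lintegral_mul_le_Lp_mul_Lq μ Real.HolderConjugate.two_two
    (f := fun s => a s ^ (1/2:ℝ)) (g := fun s => a s ^ (1/2:ℝ) * b s)
    (ha.pow_const _) ((ha.pow_const _).mul hb)
  have e1 : ∀ z : ENNReal, (z ^ (1/2:ℝ)) * z ^ (1/2:ℝ) = z := by
    intro z
    rw [← ENNReal.rpow_add_of_nonneg _ _ (by norm_num) (by norm_num)]; norm_num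
  have e2 : ∀ z : ENNReal, (z ^ (1/2:ℝ)) ^ (2:ℝ) = z := by
    intro z
    rw [← ENNReal.rpow_mul]; norm_num
  simp only [Pi.mul_apply, ← mul_assoc, e1, e2, ENNReal.mul_rpow_of_nonneg _ _ (show (0:ℝ) ≤ 2 by norm_num)] at h
  calc _ ≤ _ := ENNReal.rpow_le_rpow h (by norm_num)
    _ = _ := by
      rw [ENNReal.mul_rpow_of_nonneg _ _ (by norm_num), e2, e2]

lemma mink (μ : Measure ℝ) [SFinite μ] (k : ℝ → ℝ) (hk : AEStronglyMeasurable k μ)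
    (F : ℝ → ℝ → ℝ) (hF : Measurable (Function.uncurry F)) (B : ENNReal)
    (hB : ∀ s, ∫⁻ x, ‖F x s‖ₑ ^ (2:ℝ) ≤ B ^ (2:ℝ)) :
    eLpNorm (fun x => ∫ s, k s * F x s ∂μ) 2 volume ≤ (∫⁻ s, ‖k s‖ₑ ∂μ) * B := by
  rw [eLpNorm_eq_lintegral_rpow_enorm_toReal (by norm_num) (by norm_num)]
  have hka : AEMeasurable (fun s => ‖k s‖ₑ) μ := hk.enorm
  have hFx : ∀ x, AEMeasurable (fun s => ‖F x s‖ₑ) μ := fun x =>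
    (hF.comp measurable_prodMk_left).enorm.aemeasurable
  have key : ∫⁻ x, ‖∫ s, k s * F x s ∂μ‖ₑ ^ (2:ℝ) ≤ ((∫⁻ s, ‖k s‖ₑ ∂μ) * B) ^ (2:ℝ) := by
    calc _ ≤ ∫⁻ x, (∫⁻ s, ‖k s‖ₑ ∂μ) * ∫⁻ s, ‖k s‖ₑ * ‖F x s‖ₑ ^ (2:ℝ) ∂μ := by
          refine lintegral_mono fun x => ?_
          refine le_trans (ENNReal.rpow_le_rpow (enorm_integral_le_lintegral_enorm _) (by norm_num)) ?_
          simp only [enorm_mul]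
          exact aux_cs μ _ _ hka (hFx x)
      _ ≤ (∫⁻ s, ‖k s‖ₑ ∂μ) * ∫⁻ x, ∫⁻ s, ‖k s‖ₑ * ‖F x s‖ₑ ^ (2:ℝ) ∂μ := by
          rw [lintegral_const_mul'']
          refine AEMeasurable.lintegral_prod_right' (f := fun p : ℝ × ℝ => ‖k p.2‖ₑ * ‖F p.1 p.2‖ₑ ^ (2:ℝ)) ?_
          exact (hka.comp_quasiMeasurePreserving Measure.quasiMeasurePreserving_snd).mul
            ((hF.enorm).pow_const _).aemeasurable
      _ = (∫⁻ s, ‖k s‖ₑ ∂μ) * ∫⁻ s, ‖k s‖ₑ * (∫⁻ x, ‖F x s‖ₑ ^ (2:ℝ)) ∂μ := by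
          rw [lintegral_lintegral_swap]
          · congr 1
            refine lintegral_congr fun s => ?_
            rw [lintegral_const_mul]
            exact (hF.comp measurable_prodMk_right).enorm.pow_const _
          · exact (hka.comp_quasiMeasurePreserving Measure.quasiMeasurePreserving_snd).mul
              ((hF.enorm).pow_const _).aemeasurable
      _ ≤ (∫⁻ s, ‖k s‖ₑ ∂μ) * ∫⁻ s, ‖k s‖ₑ * B ^ (2:ℝ) ∂μ := by
          gcongr with s
          exact hB s
      _ = _ := by
          rw [lintegral_mul_const'' _ hka, ENNReal.mul_rpow_of_nonneg _ _ (by norm_num)]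
          have : ∀ z : ENNReal, z ^ (2:ℝ) = z * z := by
            intro z
            rw [show (2:ℝ) = ((2:ℕ):ℝ) by norm_num, ENNReal.rpow_natCast, sq]
          rw [this, this, mul_assoc]
  calc _ ≤ (((∫⁻ s, ‖k s‖ₑ ∂μ) * B) ^ (2:ℝ)) ^ (1/2:ℝ) := by
        simp only [ENNReal.toReal_ofNat]
        exact ENNReal.rpow_le_rpow key (by norm_num)
    _ = _ := by rw [← ENNReal.rpow_mul]; norm_num

lemma gauss_L2 (M T m : ℝ) (hM : 0 ≤ M) (hT : 0 < T) (f : ℝ → ℝ)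
    (hf : ∀ x, |f x| ≤ M * rexp (-((x - m)/√T)^2/8)) :
    ∫⁻ x, ‖f x‖ₑ ^ (2:ℝ) ≤ (ENNReal.ofReal (M * (4*π*T)^(1/4:ℝ))) ^ (2:ℝ) := by
  have h1 : ∀ x, ‖f x‖ₑ ^ (2:ℝ) ≤ ENNReal.ofReal (M^2 * rexp (-(1/(4*T)) * (x - m)^2)) := by
    intro x
    rw [← ofReal_norm, ENNReal.ofReal_rpow_of_nonneg (norm_nonneg _) (by norm_num)]
    apply ENNReal.ofReal_le_ofReal
    rw [Real.rpow_two, Real.norm_eq_abs]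
    calc |f x|^2 ≤ (M * rexp (-((x - m)/√T)^2/8))^2 := by gcongr; exact hf x
      _ = _ := by
        rw [mul_pow, ← Real.exp_nat_mul]
        congr 2
        rw [div_pow, Real.sq_sqrt hT.le]; push_cast; field_simp; ring
  refine (lintegral_mono h1).trans ?_
  have hint : Integrable (fun x : ℝ => M^2 * rexp (-(1/(4*T)) * (x - m)^2)) :=
    ((integrable_exp_neg_mul_sq (b := 1/(4*T)) (by positivity)).comp_sub_right m).const_mul _
  rw [← ofReal_integral_eq_lintegral_ofReal hint (ae_of_all _ fun x => by positivity),
    ENNReal.ofReal_rpow_of_nonneg (by positivity) (by norm_num)]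
  apply ENNReal.ofReal_le_ofReal
  rw [integral_const_mul, integral_sub_right_eq_self (fun x => rexp (-(1/(4*T)) * x^2)) m, integral_gaussian,
    Real.rpow_two, mul_pow, ← Real.rpow_natCast ((4*π*T)^(1/4:ℝ)) 2, ← Real.rpow_mul (by positivity), Real.sqrt_eq_rpow]
  apply le_of_eq
  congr 2
  · field_simp
  · norm_num

lemma dom_bound (h : ℝ → ℝ) (M T σ R x s : ℝ) (hM : 0 ≤ M) (hT : 0 < T) (hσ : σ^2 = 1)
    (hb : ∀ w, |h w| ≤ M * rexp (-w^2/8)) (hx : |x| ≤ R) :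
    |h ((x - 2*σ*s)/√T)| ≤ M * rexp (R^2/(8*T)) * rexp (-(1/(4*T)) * s^2) := by
  refine (hb _).trans ?_
  rw [mul_assoc M, ← Real.exp_add]
  gcongr
  rw [div_pow, Real.sq_sqrt hT.le]
  have h1 : x^2 ≤ R^2 := by
    rw [← sq_abs x]; gcongr
  have e : -((x - 2*σ*s)^2/T)/8 = (-(x - 2*σ*s)^2)/(8*T) := by field_simp
  have e2 : R^2/(8*T) + -(1/(4*T)) * s^2 = (R^2 - 2*s^2)/(8*T) := by field_simp; ring
  rw [e, e2]
  gcongr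
  have : (2*σ*s)^2 = 4 * s^2 := by rw [mul_pow, mul_pow, hσ]; ring
  nlinarith [sq_nonneg (2*x - 2*σ*s)]

noncomputable def Iop (σ T : ℝ) (k h : ℝ → ℝ) (x : ℝ) : ℝ :=
  ∫ s in Set.Ioi (0:ℝ), k s * h ((x - 2*σ*s)/√T)

lemma Iop_integrable (σ T α M : ℝ) (hσ : σ^2 = 1) (hT : 0 < T) (hα : 0 < α) (hM : 0 ≤ M) (k h : ℝ → ℝ)
    (hk : Measurable k) (hkb : ∀ s, 0 < s → |k s| ≤ s^(α-1)) (hh : Continuous h)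
    (hb : ∀ w, |h w| ≤ M * rexp (-w^2/8)) (x : ℝ) :
    IntegrableOn (fun s => k s * h ((x - 2*σ*s)/√T)) (Set.Ioi 0) := by
  refine Integrable.mono' ((integrableOn_rpow_mul_exp_neg_mul_sq (b := 1/(4*T)) (by positivity)
    (s := α - 1) (by linarith)).const_mul (M * rexp (|x|^2/(8*T)))) ?_ ?_
  · exact (hk.mul (by fun_prop)).aestronglyMeasurable
  · filter_upwards [ae_restrict_mem measurableSet_Ioi] with s hs
    rw [norm_mul, Real.norm_eq_abs, Real.norm_eq_abs]
    calc _ ≤ s^(α-1) * (M * rexp (|x|^2/(8*T)) * rexp (-(1/(4*T)) * s^2)) := by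
          have h0 := Real.rpow_nonneg (le_of_lt hs) (α-1)
          gcongr
          · exact hkb s hs
          · exact dom_bound h M T σ |x| x s hM hT hσ hb le_rfl
      _ = _ := by ring

lemma Iop_hasDeriv (σ T α M : ℝ) (hσ : σ^2 = 1) (hT : 0 < T) (hα : 0 < α) (hM : 0 ≤ M) (k h h' : ℝ → ℝ)
    (hk : Measurable k) (hkb : ∀ s, 0 < s → |k s| ≤ s^(α-1)) (hd : ∀ w, HasDerivAt h (h' w) w)
    (hh' : Continuous h')
    (hb : ∀ w, |h w| ≤ M * rexp (-w^2/8)) (hb' : ∀ w, |h' w| ≤ M * rexp (-w^2/8)) (x : ℝ) :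
    HasDerivAt (Iop σ T k h) ((√T)⁻¹ * Iop σ T k h' x) x := by
  have hh : Continuous h := continuous_iff_continuousAt.2 fun w => (hd w).continuousAt
  have hTs : 0 < √T := Real.sqrt_pos.2 hT
  have key := hasDerivAt_integral_of_dominated_loc_of_deriv_le (μ := volume.restrict (Set.Ioi (0:ℝ)))
    (F := fun x s => k s * h ((x - 2*σ*s)/√T))
    (F' := fun x s => k s * (h' ((x - 2*σ*s)/√T) * (1/√T)))
    (bound := fun s => (M * rexp ((|x|+1)^2/(8*T))*(1/√T)) * (s^(α-1) * rexp (-(1/(4*T)) * s^2)))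
    (x₀ := x) (Metric.ball_mem_nhds x one_pos)
    (Eventually.of_forall fun y => (hk.mul (by fun_prop)).aestronglyMeasurable)
    (Iop_integrable σ T α M hσ hT hα hM k h hk hkb hh hb x)
    ((hk.mul (by fun_prop)).aestronglyMeasurable) ?_
    ((integrableOn_rpow_mul_exp_neg_mul_sq (b := 1/(4*T)) (by positivity)
    (s := α - 1) (by linarith)).const_mul _) ?_
  · refine key.2.congr_deriv ?_
    rw [Iop, ← integral_const_mul]
    congr 1; ext s; ring
  · filter_upwards [ae_restrict_mem measurableSet_Ioi] with s hs y hy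
    have hy' : |y| ≤ |x| + 1 := by
      have := Metric.mem_ball.1 hy
      rw [Real.dist_eq] at this
      have h2 := abs_add_le x (y - x)
      rw [add_sub_cancel] at h2
      linarith
    have h0 := Real.rpow_nonneg (le_of_lt hs) (α-1)
    rw [norm_mul, norm_mul, Real.norm_eq_abs, Real.norm_eq_abs, Real.norm_eq_abs, abs_of_pos (by positivity : 0 < 1/√T)]
    calc _ ≤ s^(α-1) * ((M * rexp ((|x|+1)^2/(8*T)) * rexp (-(1/(4*T)) * s^2)) * (1/√T)) := by
          gcongr
          · exact hkb s hs
          · exact dom_bound h' M T σ _ y s hM hT hσ hb' hy'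
      _ = _ := by ring
  · refine ae_of_all _ fun s y _ => ?_
    exact (((hd ((y - 2*σ*s)/√T)).comp y (((hasDerivAt_id y).sub_const _).div_const _))).const_mul (k s)

lemma k0_integrable (α : ℝ) (h0 : 0 < α) (h1 : α < 1) :
    IntegrableOn (fun s : ℝ => s^(α-1) - (1+s)^(α-1)) (Set.Ioi 0) := by
  have hm : Measurable (fun s : ℝ => s^(α-1) - (1+s)^(α-1)) := by fun_prop
  have hnn : ∀ s : ℝ, 0 < s → 0 ≤ s^(α-1) - (1+s)^(α-1) := fun s hs =>
    sub_nonneg.2 (Real.rpow_le_rpow_of_nonpos hs (by linarith) (by linarith))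
  rw [← Set.Ioc_union_Ioi_eq_Ioi (zero_le_one (α := ℝ))]
  refine IntegrableOn.union ?_ ?_
  · have hi : IntegrableOn (fun s : ℝ => s^(α-1)) (Set.Ioc 0 1) := by
      rw [← intervalIntegrable_iff_integrableOn_Ioc_of_le zero_le_one]
      exact intervalIntegral.intervalIntegrable_rpow' (by linarith)
    refine Integrable.mono' hi hm.aestronglyMeasurable ?_
    filter_upwards [ae_restrict_mem measurableSet_Ioc] with s hs
    rw [Real.norm_eq_abs, abs_of_nonneg (hnn s hs.1)]
    have : 0 ≤ (1+s)^(α-1) := Real.rpow_nonneg (by linarith [hs.1]) _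
    linarith
  · refine Integrable.mono' (integrableOn_Ioi_rpow_of_lt (a := α-2) (by linarith) one_pos) hm.aestronglyMeasurable ?_
    filter_upwards [ae_restrict_mem measurableSet_Ioi] with s hs
    have hs1 : (1:ℝ) < s := hs
    have hs0 : 0 < s := by linarith
    rw [Real.norm_eq_abs, abs_of_nonneg (hnn s hs0)]
    have e1 : (1+s)^(α-1) = s^(α-1) * (s/(1+s))^(1-α) := by
      rw [Real.div_rpow hs0.le (by linarith), show 1 - α = -(α-1) by ring, Real.rpow_neg hs0.le, Real.rpow_neg (by linarith)]
      have := (Real.rpow_pos_of_pos hs0 (α-1)).ne'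
      have := (Real.rpow_pos_of_pos (by linarith : 0 < 1+s) (α-1)).ne'
      field_simp
    have e2 : s/(1+s) ≤ (s/(1+s))^(1-α) := by
      conv_lhs => rw [← Real.rpow_one (s/(1+s))]
      exact Real.rpow_le_rpow_of_exponent_ge (by positivity) (by rw [div_le_one (by linarith)]; linarith) (by linarith)
    have e3 : s^(α-2) = s^(α-1) * s⁻¹ := by
      rw [← Real.rpow_neg_one s, ← Real.rpow_add hs0]; congr 1; ring
    rw [e1, e3]
    have hp := Real.rpow_pos_of_pos hs0 (α-1)
    have e4 : 1 - s/(1+s) ≤ s⁻¹ := by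
      rw [one_sub_div (by linarith), inv_eq_one_div, div_le_div_iff₀ (by linarith) hs0]; linarith
    nlinarith

lemma tail_parts (σ t α M x : ℝ) (hσ : σ^2 = 1) (ht : 0 ≤ t) (h0 : 0 < α) (h1 : α < 1) (hM : 0 ≤ M)
    (H h : ℝ → ℝ) (hd : ∀ w, HasDerivAt H (h w) w) (hh : Continuous h)
    (hb : ∀ w, |h w| ≤ M * rexp (-w^2/8)) (hB : ∀ w, |H w| ≤ M * rexp (-w^2/8)) :
    ∫ s in Set.Ioi t, (1+s)^(α-1) * h ((x - 2*σ*s)/√(1+t)) =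
      (√(1+t)*σ/2) * ((1+t)^(α-1) * H ((x - 2*σ*t)/√(1+t))
        + ∫ s in Set.Ioi t, ((α-1)*(1+s)^(α-2)) * H ((x - 2*σ*s)/√(1+t))) := by
  have hT : 0 < 1 + t := by linarith
  have hTs : 0 < √(1+t) := Real.sqrt_pos.2 hT
  have hH : Continuous H := continuous_iff_continuousAt.2 fun w => (hd w).continuousAt
  have hsub : Set.Ioi t ⊆ Set.Ioi 0 := Set.Ioi_subset_Ioi ht
  have i1 : IntegrableOn (fun s => (1+s)^(α-1) * h ((x - 2*σ*s)/√(1+t))) (Set.Ioi t) := by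
    refine (Iop_integrable σ (1+t) α M hσ hT h0 hM (fun s => (1+s)^(α-1)) h (by fun_prop) ?_ hh hb x).mono_set hsub
    intro s hs
    rw [abs_of_nonneg (Real.rpow_nonneg (by linarith) _)]
    exact Real.rpow_le_rpow_of_nonpos hs (by linarith) (by linarith)
  have i2 : IntegrableOn (fun s => ((α-1)*(1+s)^(α-2)) * H ((x - 2*σ*s)/√(1+t))) (Set.Ioi t) := by
    refine (Iop_integrable σ (1+t) α M hσ hT h0 hM (fun s => (α-1)*(1+s)^(α-2)) H (by fun_prop) ?_ hH hB x).mono_set hsub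
    intro s hs
    rw [abs_mul, abs_of_nonneg (Real.rpow_nonneg (by linarith) (α-2)), abs_of_neg (by linarith)]
    have : (1+s)^(α-2) ≤ (1+s)^(α-1) := Real.rpow_le_rpow_of_exponent_le (by linarith) (by linarith)
    have h3 : (1+s)^(α-1) ≤ s^(α-1) := Real.rpow_le_rpow_of_nonpos hs (by linarith) (by linarith)
    have h4 : 0 ≤ (1+s)^(α-2) := Real.rpow_nonneg (by linarith) _
    nlinarith
  have key := integral_Ioi_of_hasDerivAt_of_tendsto' (a := t) (m := 0)
    (f := fun s => (1+s)^(α-1) * H ((x - 2*σ*s)/√(1+t)))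
    (f' := fun s => ((α-1)*(1+s)^(α-2)) * H ((x - 2*σ*s)/√(1+t))
      + (-(2*σ)/√(1+t)) * ((1+s)^(α-1) * h ((x - 2*σ*s)/√(1+t)))) ?_ (i2.add (i1.const_mul _)) ?_
  · rw [integral_add i2 (i1.const_mul _), integral_const_mul] at key
    set I1 := ∫ s in Set.Ioi t, (1+s)^(α-1) * h ((x - 2*σ*s)/√(1+t))
    set I2 := ∫ s in Set.Ioi t, ((α-1)*(1+s)^(α-2)) * H ((x - 2*σ*s)/√(1+t))
    have e : (1+t)^(α-1) * H ((x - 2*σ*t)/√(1+t)) + I2 = (2*σ/√(1+t)) * I1 := by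
      have : -(2*σ)/√(1+t) * I1 = -((2*σ/√(1+t)) * I1) := by ring
      linarith
    rw [e]
    field_simp
    linear_combination (-I1) * hσ
  · intro s hs
    have hs' : 0 < 1 + s := by have := Set.mem_Ici.1 hs; linarith
    have d1 : HasDerivAt (fun s : ℝ => (1+s)^(α-1)) ((α-1)*(1+s)^(α-2)) s := by
      have := ((hasDerivAt_id' s).const_add 1).rpow_const (p := α-1) (Or.inl hs'.ne')
      refine this.congr_deriv ?_
      ring_nf
    have d2 : HasDerivAt (fun s : ℝ => H ((x - 2*σ*s)/√(1+t))) (h ((x - 2*σ*s)/√(1+t)) * (-(2*σ*1)/√(1+t))) s :=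
      (hd _).comp s ((((hasDerivAt_id s).const_mul (2*σ)).const_sub x).div_const _)
    exact (d1.mul d2).congr_deriv (by ring)
  · have l1 : Tendsto (fun s : ℝ => (1+s)^(α-1)) atTop (nhds 0) := by
      have := (tendsto_rpow_neg_atTop (y := 1-α) (by linarith)).comp (tendsto_atTop_add_const_left atTop (1:ℝ) tendsto_id)
      refine this.congr fun s => ?_
      simp
    refine l1.zero_mul_isBoundedUnder_le ?_
    refine isBoundedUnder_of ⟨M, fun s => ?_⟩
    refine (hB _).trans ?_
    have : rexp (-((x - 2*σ*s)/√(1+t))^2/8) ≤ 1 := Real.exp_le_one_iff.2 (by nlinarith [sq_nonneg ((x - 2*σ*s)/√(1+t))])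
    nlinarith

noncomputable def kS (α t : ℝ) (s : ℝ) : ℝ := if s ≤ t then (1+s)^(α-1) else 0

lemma kS_meas (α t : ℝ) : Measurable (kS α t) := by
  unfold kS
  exact Measurable.ite measurableSet_Iic (by fun_prop) measurable_const

lemma kS_bound (α t : ℝ) (h1 : α < 1) (s : ℝ) (hs : 0 < s) : |kS α t s| ≤ s^(α-1) := by
  unfold kS
  split_ifs
  · rw [abs_of_nonneg (Real.rpow_nonneg (by linarith) _)]
    exact Real.rpow_le_rpow_of_nonpos hs (by linarith) (by linarith)
  · simpa using Real.rpow_nonneg hs.le _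

lemma split (σ t α M x : ℝ) (hσ : σ^2 = 1) (ht : 0 ≤ t) (h0 : 0 < α) (h1 : α < 1) (hM : 0 ≤ M)
    (h : ℝ → ℝ) (hh : Continuous h) (hb : ∀ w, |h w| ≤ M * rexp (-w^2/8)) :
    Iop σ (1+t) (fun s => s^(α-1)) h x - Iop σ (1+t) (kS α t) h x =
      (∫ s in Set.Ioi (0:ℝ), (s^(α-1) - (1+s)^(α-1)) * h ((x - 2*σ*s)/√(1+t)))
      + ∫ s in Set.Ioi t, (1+s)^(α-1) * h ((x - 2*σ*s)/√(1+t)) := by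
  have hT : 0 < 1 + t := by linarith
  have hb1 : ∀ s : ℝ, 0 < s → |s^(α-1)| ≤ s^(α-1) := fun s hs => by
    rw [abs_of_nonneg (Real.rpow_nonneg hs.le _)]
  have hb2 : ∀ s : ℝ, 0 < s → |(1+s)^(α-1)| ≤ s^(α-1) := fun s hs => by
    rw [abs_of_nonneg (Real.rpow_nonneg (by linarith) _)]
    exact Real.rpow_le_rpow_of_nonpos hs (by linarith) (by linarith)
  have j1 := Iop_integrable σ (1+t) α M hσ hT h0 hM _ h (by fun_prop) hb1 hh hb x
  have j2 := Iop_integrable σ (1+t) α M hσ hT h0 hM _ h (by fun_prop) hb2 hh hb x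
  have j3 := Iop_integrable σ (1+t) α M hσ hT h0 hM _ h (kS_meas α t) (kS_bound α t h1) hh hb x
  have e1 : ∫ s in Set.Ioi (0:ℝ), (s^(α-1) - (1+s)^(α-1)) * h ((x - 2*σ*s)/√(1+t)) =
      Iop σ (1+t) (fun s => s^(α-1)) h x - ∫ s in Set.Ioi (0:ℝ), (1+s)^(α-1) * h ((x - 2*σ*s)/√(1+t)) := by
    rw [Iop, ← integral_sub j1 j2]
    congr 1; ext s; ring
  have e2 : ∫ s in Set.Ioi t, (1+s)^(α-1) * h ((x - 2*σ*s)/√(1+t)) =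
      (∫ s in Set.Ioi (0:ℝ), (1+s)^(α-1) * h ((x - 2*σ*s)/√(1+t))) - Iop σ (1+t) (kS α t) h x := by
    rw [Iop, ← integral_sub j2 j3, ← integral_indicator measurableSet_Ioi, ← integral_indicator measurableSet_Ioi]
    congr 1; ext s
    simp only [Set.indicator, Set.mem_Ioi, kS]
    by_cases hs : t < s
    · have : ¬ s ≤ t := not_le.2 hs
      have : 0 < s := by linarith
      simp [*]
    · have : s ≤ t := not_lt.1 hs
      simp [*]
  rw [e1, e2]; ring

lemma Fmeas (σ T : ℝ) (h : ℝ → ℝ) (hh : Continuous h) :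
    Measurable (Function.uncurry fun x s : ℝ => h ((x - 2*σ*s)/√T)) := by
  apply Continuous.measurable
  simp only [Function.uncurry_def]
  fun_prop

lemma Iaes (σ T : ℝ) (S : Set ℝ) (k h : ℝ → ℝ) (hk : Measurable k) (hh : Continuous h) :
    AEStronglyMeasurable (fun x => ∫ s in S, k s * h ((x - 2*σ*s)/√T)) volume := by
  have : StronglyMeasurable (Function.uncurry fun x s : ℝ => k s * h ((x - 2*σ*s)/√T)) :=
    ((hk.comp measurable_snd).mul (Fmeas σ T h hh)).stronglyMeasurable
  exact this.integral_prod_right.aestronglyMeasurable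

lemma tail_mass (α t : ℝ) (ht : 0 ≤ t) (h1 : α < 1) :
    ∫⁻ s in Set.Ioi t, ‖(α-1)*(1+s)^(α-2)‖ₑ = ENNReal.ofReal ((1+t)^(α-1)) := by
  have hi : IntegrableOn (fun s : ℝ => (1+s)^(α-2)) (Set.Ioi t) := by
    have := integrableOn_add_rpow_Ioi_of_lt (a := α-2) (c := t) (m := 1) (by linarith) (by linarith)
    simpa [add_comm] using this
  have hd : ∀ s ∈ Set.Ici t, HasDerivAt (fun s : ℝ => -(1+s)^(α-1)) ((1-α)*(1+s)^(α-2)) s := by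
    intro s hs
    have hs' : 0 < 1 + s := by have := Set.mem_Ici.1 hs; linarith
    have := (((hasDerivAt_id' s).const_add 1).rpow_const (p := α-1) (Or.inl hs'.ne')).neg
    refine this.congr_deriv ?_
    ring_nf
  have l1 : Tendsto (fun s : ℝ => -(1+s)^(α-1)) atTop (nhds 0) := by
    have := ((tendsto_rpow_neg_atTop (y := 1-α) (by linarith)).comp (tendsto_atTop_add_const_left atTop (1:ℝ) tendsto_id)).neg
    rw [neg_zero] at this
    refine this.congr fun s => ?_
    simp
  have key := integral_Ioi_of_hasDerivAt_of_tendsto' hd (hi.const_mul _) l1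
  rw [zero_sub, neg_neg] at key
  rw [← key, ofReal_integral_eq_lintegral_ofReal (hi.const_mul _)]
  · refine setLIntegral_congr_fun measurableSet_Ioi fun s hs => ?_
    have hs' : 0 < 1 + s := by have := Set.mem_Ioi.1 hs; linarith
    rw [← ofReal_norm, norm_mul, Real.norm_eq_abs, Real.norm_eq_abs, abs_of_neg (by linarith),
      abs_of_pos (by positivity)]
    simp only [neg_sub]
  · filter_upwards [ae_restrict_mem measurableSet_Ioi] with s hs
    have hs' : 0 < 1 + s := by have := Set.mem_Ioi.1 hs; linarith
    have : 0 ≤ 1 - α := by linarith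
    simp only [Pi.zero_apply]
    positivity

lemma core (σ α M : ℝ) (hσ : σ^2 = 1) (h0 : 0 < α) (h1 : α ≤ 1/2) (hM : 0 ≤ M)
    (H h : ℝ → ℝ) (hd : ∀ w, HasDerivAt H (h w) w) (hh : Continuous h)
    (hb : ∀ w, |h w| ≤ M * rexp (-w^2/8)) (hB : ∀ w, |H w| ≤ M * rexp (-w^2/8)) :
    ∃ C : ℝ, 0 < C ∧ ∀ t, 0 ≤ t →
      eLpNorm (fun x => Iop σ (1+t) (fun s => s^(α-1)) h x - Iop σ (1+t) (kS α t) h x) 2 volume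
        ≤ ENNReal.ofReal (C * (1+t)^(1/4:ℝ)) := by
  have hα1 : α < 1 := by linarith
  have hH : Continuous H := continuous_iff_continuousAt.2 fun w => (hd w).continuousAt
  set K0 : ℝ := ∫ s in Set.Ioi (0:ℝ), ‖s^(α-1) - (1+s)^(α-1)‖ with hK0
  have hK0n : 0 ≤ K0 := integral_nonneg fun _ => norm_nonneg _
  have hK0e : ∫⁻ s in Set.Ioi (0:ℝ), ‖s^(α-1) - (1+s)^(α-1)‖ₑ = ENNReal.ofReal K0 :=
    (ofReal_integral_norm_eq_lintegral_enorm (k0_integrable α h0 hα1)).symm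
  refine ⟨M * (4*π)^(1/4:ℝ) * (K0 + 1) + 1, by positivity, fun t ht => ?_⟩
  have hT : 0 < 1 + t := by linarith
  have hL2 : ∀ (f : ℝ → ℝ), (∀ w, |f w| ≤ M * rexp (-w^2/8)) → ∀ s,
      ∫⁻ x, ‖f ((x - 2*σ*s)/√(1+t))‖ₑ ^ (2:ℝ) ≤ (ENNReal.ofReal (M * (4*π*(1+t))^(1/4:ℝ))) ^ (2:ℝ) :=
    fun f hf s => gauss_L2 M (1+t) (2*σ*s) hM hT _ fun x => hf _
  set B := M * (4*π*(1+t))^(1/4:ℝ) with hBdef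
  have hBn : 0 ≤ B := by positivity
  set c := √(1+t)*σ/2 with hc
  have hcabs : ‖c‖ₑ = ENNReal.ofReal (√(1+t)/2) := by
    rw [← ofReal_norm]
    congr 1
    have : |σ| = 1 := by
      rw [← sq_eq_sq₀ (abs_nonneg _) zero_le_one, sq_abs, hσ]; norm_num
    rw [hc, Real.norm_eq_abs, abs_div, abs_mul, this, abs_of_nonneg (Real.sqrt_nonneg _)]
    norm_num
  have eq : (fun x => Iop σ (1+t) (fun s => s^(α-1)) h x - Iop σ (1+t) (kS α t) h x) =
      (fun x => ∫ s in Set.Ioi (0:ℝ), (s^(α-1) - (1+s)^(α-1)) * h ((x - 2*σ*s)/√(1+t)))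
      + (c • ((1+t)^(α-1) • fun x => H ((x - 2*σ*t)/√(1+t)))
        + c • fun x => ∫ s in Set.Ioi t, ((α-1)*(1+s)^(α-2)) * H ((x - 2*σ*s)/√(1+t))) := by
    ext x
    rw [split σ t α M x hσ ht h0 hα1 hM h hh hb, tail_parts σ t α M x hσ ht h0 hα1 hM H h hd hh hb hB]
    simp only [Pi.add_apply, Pi.smul_apply, smul_eq_mul]
    ring
  have hTα : 0 ≤ (1+t)^(α-1) := Real.rpow_nonneg hT.le _
  have n1 : eLpNorm (fun x => ∫ s in Set.Ioi (0:ℝ), (s^(α-1) - (1+s)^(α-1)) * h ((x - 2*σ*s)/√(1+t))) 2 volume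
      ≤ ENNReal.ofReal (K0 * B) := by
    rw [ENNReal.ofReal_mul hK0n, ← hK0e]
    exact mink (volume.restrict (Set.Ioi 0)) (fun s => s^(α-1) - (1+s)^(α-1)) (by fun_prop)
      (fun x s => h ((x - 2*σ*s)/√(1+t))) (Fmeas σ _ h hh) _ (hL2 h hb)
  have n2 : eLpNorm (c • ((1+t)^(α-1) • fun x => H ((x - 2*σ*t)/√(1+t)))) 2 volume
      ≤ ENNReal.ofReal (√(1+t)/2 * ((1+t)^(α-1) * B)) := by
    rw [eLpNorm_const_smul, eLpNorm_const_smul, hcabs, ENNReal.ofReal_mul (by positivity), ENNReal.ofReal_mul hTα,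
      Real.enorm_of_nonneg hTα]
    gcongr
    rw [eLpNorm_eq_lintegral_rpow_enorm_toReal (by norm_num) (by norm_num)]
    simp only [ENNReal.toReal_ofNat]
    refine (ENNReal.rpow_le_rpow (hL2 H hB t) (by norm_num)).trans ?_
    rw [← ENNReal.rpow_mul]; norm_num
  have n3 : eLpNorm (c • fun x => ∫ s in Set.Ioi t, ((α-1)*(1+s)^(α-2)) * H ((x - 2*σ*s)/√(1+t))) 2 volume
      ≤ ENNReal.ofReal (√(1+t)/2 * ((1+t)^(α-1) * B)) := by
    rw [eLpNorm_const_smul, hcabs, ENNReal.ofReal_mul (by positivity), ENNReal.ofReal_mul hTα]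
    gcongr
    rw [← tail_mass α t ht hα1]
    exact mink (volume.restrict (Set.Ioi t)) (fun s => (α-1)*(1+s)^(α-2))
      (by exact Measurable.aestronglyMeasurable (by fun_prop))
      (fun x s => H ((x - 2*σ*s)/√(1+t))) (Fmeas σ _ H hH) _ (hL2 H hB)
  have m1 := Iaes σ (1+t) (Set.Ioi 0) (fun s => s^(α-1) - (1+s)^(α-1)) h (by fun_prop) hh
  have m3 := (Iaes σ (1+t) (Set.Ioi t) (fun s => (α-1)*(1+s)^(α-2)) H (by fun_prop) hH).const_smul c
  have m2 : AEStronglyMeasurable (c • ((1+t)^(α-1) • fun x => H ((x - 2*σ*t)/√(1+t)))) volume := by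
    apply Continuous.aestronglyMeasurable
    apply Continuous.const_smul
    apply Continuous.const_smul
    fun_prop
  rw [eq]
  refine (eLpNorm_add_le m1 (m2.add m3) (by norm_num)).trans ?_
  refine (add_le_add n1 ((eLpNorm_add_le m2 m3 (by norm_num)).trans (add_le_add n2 n3))).trans ?_
  rw [← ENNReal.ofReal_add (by positivity) (by positivity), ← ENNReal.ofReal_add (by positivity) (by positivity)]
  apply ENNReal.ofReal_le_ofReal
  have e1 : √(1+t) * (1+t)^(α-1) ≤ 1 := by
    rw [Real.sqrt_eq_rpow, ← Real.rpow_add hT]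
    exact Real.rpow_le_one_of_one_le_of_nonpos (by linarith) (by linarith)
  have e2 : B = M * (4*π)^(1/4:ℝ) * (1+t)^(1/4:ℝ) := by
    rw [hBdef, Real.mul_rpow (by positivity) hT.le]; ring
  have e3 : 0 ≤ (1+t)^(1/4:ℝ) := by positivity
  have e4 : √(1+t) * (1+t)^(α-1) * B ≤ B := by nlinarith
  calc _ = K0 * B + √(1+t) * (1+t)^(α-1) * B := by ring
    _ ≤ K0 * B + B := by linarith
    _ ≤ _ := by rw [e2]; nlinarith

noncomputable def P0 (w : ℝ) : ℝ := rexp (-w^2/4)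
noncomputable def P1 (w : ℝ) : ℝ := -(w/2) * rexp (-w^2/4)
noncomputable def P2 (w : ℝ) : ℝ := (w^2/4 - 1/2) * rexp (-w^2/4)

lemma P_exp_deriv (w : ℝ) : HasDerivAt (fun w : ℝ => rexp (-w^2/4)) (-(w/2) * rexp (-w^2/4)) w := by
  have := (((hasDerivAt_pow 2 w).neg).div_const 4).exp
  refine this.congr_deriv ?_
  simp only [Pi.neg_apply]
  push_cast; ring

lemma P0_deriv (w : ℝ) : HasDerivAt P0 (P1 w) w := P_exp_deriv w

lemma P1_deriv (w : ℝ) : HasDerivAt P1 (P2 w) w := by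
  have := (((hasDerivAt_id' w).div_const 2).neg).mul (P_exp_deriv w)
  refine this.congr_deriv ?_
  simp only [Pi.neg_apply, P2]
  ring

lemma P1_cont : Continuous P1 := by unfold P1; fun_prop
lemma P2_cont : Continuous P2 := by unfold P2; fun_prop

lemma P_gen (q w : ℝ) (hq : |q| ≤ 2 * (w^2/8 + 1)) : |q * rexp (-w^2/4)| ≤ 2 * rexp (-w^2/8) := by
  rw [abs_mul, abs_of_pos (Real.exp_pos _)]
  have e : rexp (-w^2/4) = rexp (-w^2/8) * rexp (-w^2/8) := by rw [← Real.exp_add]; ring_nf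
  have h1 : (w^2/8 + 1) * rexp (-w^2/8) ≤ 1 := by
    have := Real.add_one_le_exp (w^2/8)
    calc _ ≤ rexp (w^2/8) * rexp (-w^2/8) := by gcongr
      _ = 1 := by rw [← Real.exp_add]; ring_nf; simp
  calc |q| * rexp (-w^2/4) ≤ (2 * (w^2/8 + 1)) * rexp (-w^2/4) := by gcongr
    _ = 2 * ((w^2/8 + 1) * rexp (-w^2/8)) * rexp (-w^2/8) := by rw [e]; ring
    _ ≤ 2 * 1 * rexp (-w^2/8) := by gcongr
    _ = _ := by ring

lemma P0_bound (w : ℝ) : |P0 w| ≤ 2 * rexp (-w^2/8) := by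
  have := P_gen 1 w (by rw [abs_one]; nlinarith [sq_nonneg w])
  simpa [P0] using this

lemma P1_bound (w : ℝ) : |P1 w| ≤ 2 * rexp (-w^2/8) :=
  P_gen _ w (abs_le.2 ⟨by nlinarith [sq_nonneg (w-1)], by nlinarith [sq_nonneg (w+1)]⟩)

lemma P2_bound (w : ℝ) : |P2 w| ≤ 2 * rexp (-w^2/8) :=
  P_gen _ w (abs_le.2 ⟨by nlinarith [sq_nonneg w], by nlinarith [sq_nonneg w]⟩)

lemma fn_eq (n : ℕ) (σ x T : ℝ) (hσ : σ^2 = 1) (hT : 0 < T) :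
    fn n (-σ * x / √T) = 2 * σ * (2/√T)^((2:ℝ)^(-(n:ℝ))) * Iop σ T (fun s => s^((2:ℝ)^(-(n:ℝ)) - 1)) P1 x := by
  set α := (2:ℝ)^(-(n:ℝ))
  have hTs : 0 < √T := Real.sqrt_pos.2 hT
  have hb : 0 < 2/√T := by positivity
  set b := 2/√T with hbdef
  set z := -σ * x / √T with hz
  have s1 : fn n z = ∫ v in Set.Ioi (0:ℝ), (z+v) * rexp (-(z+v)^2/4) * v^(α-1) := by
    have := (measurePreserving_add_left volume z).setIntegral_preimage_emb
      (measurableEmbedding_addLeft z) (fun ξ => ξ * rexp (-ξ^2/4) * (ξ - z)^(α-1)) (Set.Ioi z)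
    rw [fn, ← this]
    simp
  have s2 := integral_comp_mul_left_Ioi' (fun v => (z+v) * rexp (-(z+v)^2/4) * v^(α-1)) 0 hb
  rw [mul_zero] at s2
  rw [s1, ← s2, smul_eq_mul, Iop, ← integral_const_mul, ← integral_const_mul]
  refine setIntegral_congr_fun measurableSet_Ioi fun s hs => ?_
  have hs0 : 0 < s := hs
  have hzb : z + b * s = -σ * ((x - 2*σ*s)/√T) := by
    rw [hz, hbdef]; field_simp; linear_combination (-2*s) * hσ
  simp only [hzb, P1]
  have e2 : (-σ * ((x - 2*σ*s)/√T))^2 = ((x - 2*σ*s)/√T)^2 := by rw [mul_pow, neg_sq, hσ, one_mul]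
  rw [e2, Real.mul_rpow hb.le hs0.le, Real.rpow_sub_one hb.ne']
  field_simp

lemma selfSim_eq (n : ℕ) (σ x t : ℝ) (hσ : σ^2 = 1) (ht : 0 ≤ t) :
    selfSimU n σ x t = ((1+t)⁻¹ / √(4*π)) * Iop σ (1+t) (fun s => s^((2:ℝ)^(-(n:ℝ)) - 1)) P1 x := by
  have hT : 0 < 1 + t := by linarith
  rw [selfSimU, fn_eq n σ x (1+t) hσ hT]
  have e0 : (2:ℝ)^(-(n:ℝ) - 1) = (2:ℝ)^(-(n:ℝ)) / 2 := by
    rw [Real.rpow_sub_one (by norm_num)]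
  rw [e0]
  set α := (2:ℝ)^(-(n:ℝ))
  have e1 : (2/√(1+t))^α = 2^α * (1+t)^(-(α/2)) := by
    rw [Real.div_rpow (by norm_num) (Real.sqrt_nonneg _), Real.sqrt_eq_rpow, ← Real.rpow_mul hT.le,
      Real.rpow_neg hT.le, div_eq_mul_inv]
    congr 3; ring
  have e2 : (1+t)^(-(1:ℝ) + α/2) * (1+t)^(-(α/2)) = (1+t)⁻¹ := by
    rw [← Real.rpow_add hT, ← Real.rpow_neg_one]; congr 1; ring
  have e3 : (2:ℝ)^(-(1:ℝ) - α) * 2^α = 1/2 := by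
    rw [← Real.rpow_add (by norm_num), show -(1:ℝ) - α + α = -1 by ring, Real.rpow_neg_one]; norm_num
  rw [e1]
  set I := Iop σ (1+t) (fun s => s^(α - 1)) P1 x
  calc _ = σ^2 * ((1+t)^(-(1:ℝ) + α/2) * (1+t)^(-(α/2))) * ((2:ℝ)^(-(1:ℝ) - α) * 2^α) * 2 / √(4*π) * I := by ring
    _ = _ := by rw [hσ, e2, e3]; ring

lemma gauss_conv (a b x m : ℝ) (ha : 0 < a) (hb : 0 < b) :
    ∫ y : ℝ, deriv (fun x' => heatKernel a (x' - y)) x * rexp (-(y - m)^2/(4*b)) =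
      √b * (a+b)⁻¹ * P1 ((x - m)/√(a+b)) := by
  have hd : ∀ y, deriv (fun x' => heatKernel a (x' - y)) x =
      -(x-y)/(2*a) * rexp (-(x-y)^2/(4*a)) / √(4*π*a) := by
    intro y
    apply HasDerivAt.deriv
    have := (((((((hasDerivAt_id' x).sub_const y).pow 2).neg).div_const (4*a))).exp).div_const (√(4*π*a))
    unfold heatKernel
    refine this.congr_deriv ?_
    simp only [Pi.neg_apply, Pi.pow_apply]
    push_cast
    field_simp
    ring
  set c := (a+b)/(4*a*b) with hc
  have hcp : 0 < c := by positivity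
  set y0 := (b*x + a*m)/(a+b) with hy0
  set K := rexp (-(x-m)^2/(4*(a+b))) / (2*a) / √(4*π*a) with hK
  have hab : a + b ≠ 0 := by positivity
  have e1 : ∀ y, deriv (fun x' => heatKernel a (x' - y)) x * rexp (-(y - m)^2/(4*b)) =
      K * ((y - y0) * rexp (-c * (y-y0)^2)) + K * (y0 - x) * rexp (-c * (y-y0)^2) := by
    intro y
    have : rexp (-(x-y)^2/(4*a)) * rexp (-(y - m)^2/(4*b)) =
        rexp (-(x-m)^2/(4*(a+b))) * rexp (-c * (y-y0)^2) := by
      rw [← Real.exp_add, ← Real.exp_add]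
      congr 1
      rw [hc, hy0]; field_simp; ring
    rw [hd]
    calc _ = (y - x)/(2*a)/√(4*π*a) * (rexp (-(x-y)^2/(4*a)) * rexp (-(y - m)^2/(4*b))) := by ring
      _ = _ := by rw [this, hK]; ring
  simp only [e1]
  have i1 : Integrable (fun y : ℝ => (y - y0) * rexp (-c * (y-y0)^2)) :=
    (integrable_mul_exp_neg_mul_sq hcp).comp_sub_right y0
  have i2 : Integrable (fun y : ℝ => rexp (-c * (y-y0)^2)) :=
    (integrable_exp_neg_mul_sq hcp).comp_sub_right y0
  rw [integral_add (i1.const_mul _) (i2.const_mul _), integral_const_mul, integral_const_mul,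
    integral_sub_right_eq_self (fun y => y * rexp (-c * y^2)) y0,
    integral_sub_right_eq_self (fun y => rexp (-c * y^2)) y0, integral_gaussian]
  have odd : ∫ y : ℝ, y * rexp (-c * y^2) = 0 := by
    have := integral_neg_eq_self (fun y : ℝ => y * rexp (-c * y^2)) volume
    simp only [neg_sq, neg_mul, integral_neg] at this ⊢
    linarith
  rw [odd, mul_zero, zero_add, hK, P1, div_pow, Real.sq_sqrt (by positivity)]
  have e3 : -((x-m)^2/(a+b))/4 = -(x-m)^2/(4*(a+b)) := by field_simp
  have e4 : √(π/c) = √(4*π*a) * √b / √(a+b) := by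
    rw [← Real.sqrt_mul (by positivity), ← Real.sqrt_div (by positivity)]
    congr 1; rw [hc]; field_simp
  have e5 : y0 - x = a * (m - x)/(a+b) := by rw [hy0]; field_simp; ring
  rw [e3, e4, e5]
  have : √(4*π*a) ≠ 0 := by positivity
  have : √(a+b) ≠ 0 := by positivity
  field_simp
  ring

lemma duhamel_eq (n : ℕ) (σ x t : ℝ) (ht : 0 ≤ t) :
    duhamel (gaussForcing n σ) x t = ((1+t)⁻¹ / √(4*π)) * Iop σ (1+t) (kS ((2:ℝ)^(-(n:ℝ))) t) P1 x := by
  have hT : 0 < 1 + t := by linarith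
  set α := (2:ℝ)^(-(n:ℝ)) with hα
  rw [duhamel, intervalIntegral.integral_of_le ht, Iop, ← integral_const_mul]
  have e1 : ∫ s in Set.Ioi (0:ℝ), (1+t)⁻¹ / √(4*π) * (kS α t s * P1 ((x - 2*σ*s)/√(1+t))) =
      ∫ s in Set.Ioc (0:ℝ) t, (1+t)⁻¹ / √(4*π) * ((1+s)^(α-1) * P1 ((x - 2*σ*s)/√(1+t))) := by
    rw [← integral_indicator measurableSet_Ioi, ← integral_indicator measurableSet_Ioc]
    congr 1; ext s
    simp only [Set.indicator, Set.mem_Ioi, Set.mem_Ioc, kS]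
    by_cases hs : 0 < s <;> by_cases hs2 : s ≤ t <;> simp [*]
  rw [e1]
  refine integral_congr_ae ?_
  have hne : ∀ᵐ s ∂(volume.restrict (Set.Ioc (0:ℝ) t)), s ≠ t :=
    ae_restrict_of_ae (by simp [ae_iff])
  filter_upwards [ae_restrict_mem measurableSet_Ioc, hne] with s hs hst
  have hs1 : 0 < t - s := sub_pos.2 (lt_of_le_of_ne hs.2 hst)
  have hs2 : 0 < 1 + s := by linarith [hs.1]
  have g := gauss_conv (t-s) (1+s) x (2*σ*s) hs1 hs2
  rw [show t - s + (1+s) = 1 + t by ring] at g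
  calc _ = ∫ y, ((1+s)^(α-3/2)/√(4*π)) * (deriv (fun x' => heatKernel (t-s) (x' - y)) x * rexp (-(y - 2*σ*s)^2/(4*(1+s)))) := by
        congr 1; ext y; rw [gaussForcing]; ring
    _ = _ := by
        rw [integral_const_mul, g]
        have : (1+s)^(α-1) = (1+s)^(α-3/2) * √(1+s) := by
          rw [Real.sqrt_eq_rpow, ← Real.rpow_add hs2]; congr 1; ring
        rw [this]; ring

/-- for the Gaussian forcing, the Duhamel solution converges to `u_n`:
`‖u(·,t) − u_n(·,t)‖_{L²} ≤ C (1+t)^{-3/4}` and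
`‖∂_x u(·,t) − ∂_x u_n(·,t)‖_{L²} ≤ C (1+t)^{-5/4}`. -/
theorem stmt_17 (n : ℕ) (hn : 1 ≤ n) (σ : ℝ) (hσ : σ = 1 ∨ σ = -1) :
    ∃ C : ℝ, 0 < C ∧ ∀ t : ℝ, 0 ≤ t →
      eLpNorm (fun x : ℝ =>
          duhamel (gaussForcing n σ) x t - selfSimU n σ x t) 2 volume
        ≤ ENNReal.ofReal (C * (1 + t) ^ (-(3:ℝ)/4)) ∧
      eLpNorm (fun x : ℝ =>
          deriv (fun x' => duhamel (gaussForcing n σ) x' t) x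
            - deriv (fun x' => selfSimU n σ x' t) x) 2 volume
        ≤ ENNReal.ofReal (C * (1 + t) ^ (-(5:ℝ)/4)) := by
  have hσ2 : σ^2 = 1 := by rcases hσ with h | h <;> rw [h] <;> norm_num
  have hα0 : 0 < (2:ℝ)^(-(n:ℝ)) := by positivity
  have hα1 : (2:ℝ)^(-(n:ℝ)) ≤ 1/2 := by
    have : (1:ℝ) ≤ n := by exact_mod_cast hn
    calc (2:ℝ)^(-(n:ℝ)) ≤ (2:ℝ)^(-(1:ℝ)) := Real.rpow_le_rpow_of_exponent_le (by norm_num) (by linarith)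
      _ = 1/2 := by rw [Real.rpow_neg_one]; norm_num
  obtain ⟨C1, hC1, H1⟩ := core σ _ 2 hσ2 hα0 hα1 (by norm_num) P0 P1 P0_deriv P1_cont P1_bound P0_bound
  obtain ⟨C2, hC2, H2⟩ := core σ _ 2 hσ2 hα0 hα1 (by norm_num) P1 P2 P1_deriv P2_cont P2_bound P1_bound
  have hp : 0 < √(4*π) := by positivity
  refine ⟨(C1 + C2)/√(4*π), by positivity, fun t ht => ?_⟩
  have hT : 0 < 1 + t := by linarith
  have hU : (fun x' => selfSimU n σ x' t) = fun x' => ((1+t)⁻¹ / √(4*π)) *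
      Iop σ (1+t) (fun s => s^((2:ℝ)^(-(n:ℝ)) - 1)) P1 x' := funext fun x' => selfSim_eq n σ x' t hσ2 ht
  have hD : (fun x' => duhamel (gaussForcing n σ) x' t) = fun x' => ((1+t)⁻¹ / √(4*π)) *
      Iop σ (1+t) (kS ((2:ℝ)^(-(n:ℝ))) t) P1 x' := funext fun x' => duhamel_eq n σ x' t ht
  have dU : ∀ x, deriv (fun x' => selfSimU n σ x' t) x = ((1+t)⁻¹ / √(4*π)) *
      ((√(1+t))⁻¹ * Iop σ (1+t) (fun s => s^((2:ℝ)^(-(n:ℝ)) - 1)) P2 x) := by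
    intro x
    rw [hU]
    refine HasDerivAt.deriv (HasDerivAt.const_mul _ ?_)
    exact Iop_hasDeriv σ (1+t) _ 2 hσ2 hT hα0 (by norm_num) _ P1 P2 (by fun_prop)
      (fun s hs => by rw [abs_of_nonneg (Real.rpow_nonneg hs.le _)]) P1_deriv P2_cont P1_bound P2_bound x
  have dD : ∀ x, deriv (fun x' => duhamel (gaussForcing n σ) x' t) x = ((1+t)⁻¹ / √(4*π)) *
      ((√(1+t))⁻¹ * Iop σ (1+t) (kS ((2:ℝ)^(-(n:ℝ))) t) P2 x) := by
    intro x
    rw [hD]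
    refine HasDerivAt.deriv (HasDerivAt.const_mul _ ?_)
    exact Iop_hasDeriv σ (1+t) _ 2 hσ2 hT hα0 (by norm_num) _ P1 P2 (kS_meas _ _)
      (kS_bound _ _ (by linarith)) P1_deriv P2_cont P1_bound P2_bound x
  constructor
  · have e : (fun x : ℝ => duhamel (gaussForcing n σ) x t - selfSimU n σ x t) =
        (-((1+t)⁻¹ / √(4*π))) • fun x => (Iop σ (1+t) (fun s => s^((2:ℝ)^(-(n:ℝ)) - 1)) P1 x
          - Iop σ (1+t) (kS ((2:ℝ)^(-(n:ℝ))) t) P1 x) := by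
      ext x
      rw [duhamel_eq n σ x t ht, selfSim_eq n σ x t hσ2 ht]
      simp only [Pi.smul_apply, smul_eq_mul]; ring
    rw [e, eLpNorm_const_smul, enorm_neg, Real.enorm_of_nonneg (by positivity)]
    refine (mul_le_mul_right (H1 t ht) _).trans ?_
    rw [← ENNReal.ofReal_mul (by positivity)]
    apply ENNReal.ofReal_le_ofReal
    have e2 : (1+t)^(-(3:ℝ)/4) = (1+t)⁻¹ * (1+t)^(1/4:ℝ) := by
      rw [← Real.rpow_neg_one, ← Real.rpow_add hT]; norm_num
    rw [e2]
    calc _ = C1 / √(4*π) * ((1+t)⁻¹ * (1+t)^(1/4:ℝ)) := by ring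
      _ ≤ _ := by gcongr; linarith
  · have e : (fun x : ℝ => deriv (fun x' => duhamel (gaussForcing n σ) x' t) x
            - deriv (fun x' => selfSimU n σ x' t) x) =
        (-((1+t)⁻¹ / √(4*π) * (√(1+t))⁻¹)) • fun x => (Iop σ (1+t) (fun s => s^((2:ℝ)^(-(n:ℝ)) - 1)) P2 x
          - Iop σ (1+t) (kS ((2:ℝ)^(-(n:ℝ))) t) P2 x) := by
      ext x
      rw [dU, dD]
      simp only [Pi.smul_apply, smul_eq_mul]; ring
    rw [e, eLpNorm_const_smul, enorm_neg, Real.enorm_of_nonneg (by positivity)]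
    refine (mul_le_mul_right (H2 t ht) _).trans ?_
    rw [← ENNReal.ofReal_mul (by positivity)]
    apply ENNReal.ofReal_le_ofReal
    have e2 : (1+t)^(-(5:ℝ)/4) = (1+t)⁻¹ * (√(1+t))⁻¹ * (1+t)^(1/4:ℝ) := by
      rw [Real.sqrt_eq_rpow, ← Real.rpow_neg_one, ← Real.rpow_neg hT.le, ← Real.rpow_add hT, ← Real.rpow_add hT]; norm_num
    rw [e2]
    calc _ = C2 / √(4*π) * ((1+t)⁻¹ * (√(1+t))⁻¹ * (1+t)^(1/4:ℝ)) := by ring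
      _ ≤ _ := by gcongr; linarith
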